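/- Let d ≥ 1, let E be a set of matrix positions (pairs (i,j) with 1 ≤ i,j ≤ d), let e ∈ E, and let Σ be a symmetric positive definite real d×d matrix. Suppose there exist real d×d matrices A⁻, D⁻ with D⁻ diagonal with strictly positive diagonal entries, A⁻Σ + Σ(A⁻)ᵀ = −D⁻, supp(A⁻) = E and the entry of A⁻ at position e strictly negative; and suppose there exist A⁰, D⁰ with D⁰ diagonal with strictly positive diagonal entries, A⁰Σ + Σ(A⁰)ᵀ = −D⁰, supp(A⁰) ⊆ E, and the entry of A⁰ at position e equal to 0. Then there exist real d×d matrices A⁺, D⁺ such that D⁺ is diagonal with strictly positive diagonal entries, A⁺Σ + Σ(A⁺)ᵀ = −D⁺, supp(A⁺) = E, and the entry of A⁺ at position e is strictly positive. -/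

import Mathlib

open Matrix

/-- `D` is a diagonal matrix with strictly positive diagonal entries. -/
def IsDiagPos {d : ℕ} (D : Matrix (Fin d) (Fin d) ℝ) : Prop :=
  (∀ i, 0 < D i i) ∧ ∀ i j, i ≠ j → D i j = 0

/-- A line `a - t * b` with `b ≠ 0` avoids zero for all small `t > 0`. -/
theorem eventually_sub_mul_ne_zero {a b : ℝ} (hb : b ≠ 0) :
    ∀ᶠ t : ℝ in nhdsWithin 0 (Set.Ioi 0), a - t * b ≠ 0 := by
  by_cases ha : a = 0
  · filter_upwards [self_mem_nhdsWithin] with t ht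
    simpa [ha, hb] using (Set.mem_Ioi.1 ht).ne'
  · have hc : ContinuousAt (fun t : ℝ => a - t * b) 0 := by fun_prop
    exact nhdsWithin_le_nhds (hc.eventually_ne (by simpa using ha))

/-- A line `a - t * b` with `a > 0` stays positive for all small `t > 0`. -/
theorem eventually_sub_mul_pos {a : ℝ} (b : ℝ) (ha : 0 < a) :
    ∀ᶠ t : ℝ in nhdsWithin 0 (Set.Ioi 0), 0 < a - t * b := by
  have hc : ContinuousAt (fun t : ℝ => a - t * b) 0 := by fun_prop
  exact nhdsWithin_le_nhds (hc.eventually_const_lt (by simpa using ha))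

theorem stmt_2 (d : ℕ) (hd : 1 ≤ d) (E : Set (Fin d × Fin d)) (e : Fin d × Fin d)
    (he : e ∈ E) (S : Matrix (Fin d) (Fin d) ℝ) (hS : S.PosDef)
    (hminus : ∃ A D : Matrix (Fin d) (Fin d) ℝ, IsDiagPos D ∧
      A * S + S * Aᵀ = -D ∧ (∀ i j, A i j ≠ 0 ↔ (i, j) ∈ E) ∧ A e.1 e.2 < 0)
    (hzero : ∃ A D : Matrix (Fin d) (Fin d) ℝ, IsDiagPos D ∧
      A * S + S * Aᵀ = -D ∧ (∀ i j, (i, j) ∉ E → A i j = 0) ∧ A e.1 e.2 = 0) :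
    ∃ A D : Matrix (Fin d) (Fin d) ℝ, IsDiagPos D ∧
      A * S + S * Aᵀ = -D ∧ (∀ i j, A i j ≠ 0 ↔ (i, j) ∈ E) ∧ 0 < A e.1 e.2 := by
  obtain ⟨A, D, hD, hAD, hA, hAe⟩ := hminus
  obtain ⟨A₀, D₀, hD₀, hAD₀, hA₀, hA₀e⟩ := hzero
  have hdiag : ∀ᶠ t : ℝ in nhdsWithin 0 (Set.Ioi 0), ∀ i, 0 < D₀ i i - t * D i i :=
    Filter.eventually_all.2 fun i => eventually_sub_mul_pos _ (hD₀.1 i)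
  have hsupp : ∀ᶠ t : ℝ in nhdsWithin 0 (Set.Ioi 0),
      ∀ i j, A i j ≠ 0 → A₀ i j - t * A i j ≠ 0 := by
    refine Filter.eventually_all.2 fun i => Filter.eventually_all.2 fun j => ?_
    by_cases h : A i j = 0
    · simp [h]
    · filter_upwards [eventually_sub_mul_ne_zero (a := A₀ i j) h] with t ht _ using ht
  have hpos : ∀ᶠ t : ℝ in nhdsWithin 0 (Set.Ioi 0), 0 < t := self_mem_nhdsWithin
  obtain ⟨t, htD, htA, ht⟩ := (hdiag.and (hsupp.and hpos)).exists
  refine ⟨A₀ - t • A, D₀ - t • D, ⟨htD, fun i j hij => ?_⟩, ?_,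
    fun i j => ⟨fun h => ?_, fun h => ?_⟩, ?_⟩
  · simp [hD.2 i j hij, hD₀.2 i j hij]
  · calc (A₀ - t • A) * S + S * (A₀ - t • A)ᵀ
        = (A₀ * S + S * A₀ᵀ) - t • (A * S + S * Aᵀ) := by
          simp only [transpose_sub, transpose_smul, sub_mul, mul_sub, smul_mul_assoc,
            mul_smul_comm, smul_add]
          abel
      _ = -(D₀ - t • D) := by
          rw [hAD, hAD₀, smul_neg]
          abel
  · by_contra hE
    have hAij : A i j = 0 := not_not.1 (mt (hA i j).1 hE)
    exact h (by simp [hAij, hA₀ i j hE])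
  · exact htA i j ((hA i j).2 h)
  · simpa [hA₀e] using mul_neg_of_pos_of_neg ht hAe
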